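/- Let a ∈ (1/2,1), θ ∈ (0,1), σ₃ a nonnegative integer and σ₄ > 1. For every t ≥ 0 there exists a constant C = C(t,a,θ,σ₃,σ₄) such that for all f : ℝ² → ℂ with the right-hand side finite, ‖𝒟^θ_ξ(χ(ξ,η) ψ(ξ,η,t) η^{σ₃} |ξ|^a f̂)‖_{L²(ℝ²)} ≤ C(‖J_x^{2a} f‖ + ‖⟨x⟩² f‖ + ‖⟨y⟩^{σ₄} f‖). -/

import Mathlib

open MeasureTheory Real Set
open scoped ENNReal

noncomputable section

/-- Fourier transform on ℝ². -/
def FT (f : ℝ × ℝ → ℂ) : ℝ × ℝ → ℂ := fun ζ =>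
  ∫ p : ℝ × ℝ, Complex.exp (-(Complex.I * ((p.1 * ζ.1 + p.2 * ζ.2 : ℝ) : ℂ))) * f p

/-- Inverse Fourier transform on ℝ². -/
def invFT (g : ℝ × ℝ → ℂ) : ℝ × ℝ → ℂ := fun p =>
  ((((2 * Real.pi) ^ 2 : ℝ)⁻¹ : ℝ) : ℂ) *
    ∫ ζ : ℝ × ℝ, Complex.exp (Complex.I * ((p.1 * ζ.1 + p.2 * ζ.2 : ℝ) : ℂ)) * g ζ

/-- Fourier multiplier operator with symbol `m`. -/
def fourierMult (m : ℝ × ℝ → ℂ) (f : ℝ × ℝ → ℂ) : ℝ × ℝ → ℂ :=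
  invFT fun ζ => m ζ * FT f ζ

/-- Bessel operator in the x-direction, symbol (1+ξ²)^{s/2}. -/
def Jx (s : ℝ) : (ℝ × ℝ → ℂ) → ℝ × ℝ → ℂ :=
  fourierMult fun ζ => (((1 + ζ.1 ^ 2) ^ (s / 2) : ℝ) : ℂ)

/-- Riesz operator in the x-direction, symbol |ξ|^s. -/
def Dx (s : ℝ) : (ℝ × ℝ → ℂ) → ℝ × ℝ → ℂ :=
  fourierMult fun ζ => ((|ζ.1| ^ s : ℝ) : ℂ)

/-- Riesz operator in the y-direction, symbol |η|^s. -/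
def Dy (s : ℝ) : (ℝ × ℝ → ℂ) → ℝ × ℝ → ℂ :=
  fourierMult fun ζ => ((|ζ.2| ^ s : ℝ) : ℂ)

/-- The symbol ψ(ξ,η,t) = exp(i t ξ(η² − |ξ|^{1+a})) of the linear gBO-ZK group. -/
def psi (a t : ℝ) (ζ : ℝ × ℝ) : ℂ :=
  Complex.exp (Complex.I * ((t * ζ.1 * (ζ.2 ^ 2 - |ζ.1| ^ (1 + a)) : ℝ) : ℂ))

/-- Stein derivative of order b in the first (ξ) variable of g : ℝ² → ℂ. -/
def steinDxi (b : ℝ) (g : ℝ × ℝ → ℂ) (p : ℝ × ℝ) : ℝ≥0∞ :=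
  (∫⁻ y : ℝ, ENNReal.ofReal (‖g p - g (y, p.2)‖ ^ 2 / |p.1 - y| ^ (1 + 2 * b))) ^ (1 / 2 : ℝ)

/-- The L²(ℝ²) norm of the Stein derivative 𝒟^b_ξ g. -/
def steinL2norm (b : ℝ) (g : ℝ × ℝ → ℂ) : ℝ≥0∞ :=
  (∫⁻ p : ℝ × ℝ, steinDxi b g p ^ 2) ^ (1 / 2 : ℝ)

/-! ### Plancherel's inequality for integrable functions on the plane -/

/-- The Gaussian weight `exp (-ε |ζ|²)` on the plane. -/
def gaussWeight (ε : ℝ) (ζ : ℝ × ℝ) : ℝ :=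
  Real.exp (-ε * ζ.1 ^ 2) * Real.exp (-ε * ζ.2 ^ 2)

theorem continuous_gaussWeight (ε : ℝ) : Continuous (gaussWeight ε) := by
  unfold gaussWeight; fun_prop

theorem gaussWeight_nonneg (ε : ℝ) (ζ : ℝ × ℝ) : 0 ≤ gaussWeight ε ζ := by
  unfold gaussWeight; positivity

theorem integrable_gaussWeight {ε : ℝ} (hε : 0 < ε) : Integrable (gaussWeight ε) :=
  (integrable_exp_neg_mul_sq hε).mul_prod (integrable_exp_neg_mul_sq hε)

theorem integral_gaussWeight {ε : ℝ} (hε : 0 < ε) : ∫ ζ, gaussWeight ε ζ = π / ε := by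
  unfold gaussWeight
  rw [Measure.volume_eq_prod,
    integral_prod_mul (fun x : ℝ => Real.exp (-ε * x ^ 2)) (fun x : ℝ => Real.exp (-ε * x ^ 2)),
    integral_gaussian, Real.mul_self_sqrt (by positivity)]

/-- The Fourier transform of the Gaussian weight. -/
theorem FT_gaussWeight {ε : ℝ} (hε : 0 < ε) (z : ℝ × ℝ) :
    ∫ ζ : ℝ × ℝ, Complex.exp (-(Complex.I * ((z.1 * ζ.1 + z.2 * ζ.2 : ℝ) : ℂ))) *
      (gaussWeight ε ζ : ℂ) = ((π / ε * gaussWeight (1 / (4 * ε)) z : ℝ) : ℂ) := by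
  have hb : 0 < (ε : ℂ).re := by simpa using hε
  have h : ∀ ζ : ℝ × ℝ, Complex.exp (-(Complex.I * ((z.1 * ζ.1 + z.2 * ζ.2 : ℝ) : ℂ))) *
      (gaussWeight ε ζ : ℂ) =
      (Complex.exp (Complex.I * (-z.1 : ℂ) * ζ.1) * Complex.exp (-(ε : ℂ) * ζ.1 ^ 2)) *
      (Complex.exp (Complex.I * (-z.2 : ℂ) * ζ.2) * Complex.exp (-(ε : ℂ) * ζ.2 ^ 2)) := by
    intro ζ
    unfold gaussWeight
    push_cast
    simp only [← Complex.exp_add]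
    congr 1
    ring
  simp_rw [h]
  rw [Measure.volume_eq_prod, integral_prod_mul
    (fun x : ℝ => Complex.exp (Complex.I * (-z.1 : ℂ) * x) * Complex.exp (-(ε : ℂ) * x ^ 2))
    (fun x : ℝ => Complex.exp (Complex.I * (-z.2 : ℂ) * x) * Complex.exp (-(ε : ℂ) * x ^ 2)),
    fourierIntegral_gaussian hb, fourierIntegral_gaussian hb]
  have hsq : ((π : ℂ) / ε) ^ (1 / 2 : ℂ) * ((π : ℂ) / ε) ^ (1 / 2 : ℂ) = (π : ℂ) / ε := by
    rw [← Complex.cpow_add _ _ (by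
      have := Real.pi_ne_zero
      have := hε.ne'
      simp [*])]
    norm_num
  unfold gaussWeight
  push_cast
  have e1 : ∀ s : ℝ, Complex.exp (-(-(s : ℂ)) ^ 2 / (4 * ε)) =
      Complex.exp (-(1 / (4 * (ε : ℂ))) * (s : ℂ) ^ 2) := by
    intro s; congr 1; ring
  rw [e1, e1, mul_mul_mul_comm, hsq]

theorem norm_cexp_neg_I_mul_ofReal (x : ℝ) : ‖Complex.exp (-(Complex.I * (x : ℂ)))‖ = 1 := by
  rw [← mul_neg, mul_comm, ← Complex.ofReal_neg, Complex.norm_exp_ofReal_mul_I]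

theorem continuous_FT {u : ℝ × ℝ → ℂ} (hu : Integrable u) : Continuous (FT u) := by
  unfold FT
  refine continuous_of_dominated (bound := fun p => ‖u p‖) ?_ ?_ hu.norm ?_
  · intro ζ
    refine AEStronglyMeasurable.mul (Continuous.aestronglyMeasurable (by fun_prop)) hu.1
  · intro ζ
    refine Filter.Eventually.of_forall fun p => ?_
    rw [norm_mul, norm_cexp_neg_I_mul_ofReal, one_mul]
  · refine Filter.Eventually.of_forall fun p => ?_
    fun_prop

theorem norm_FT_le (u : ℝ × ℝ → ℂ) (ζ : ℝ × ℝ) : ‖FT u ζ‖ ≤ ∫ p, ‖u p‖ := by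
  unfold FT
  refine (norm_integral_le_integral_norm _).trans (le_of_eq ?_)
  simp_rw [norm_mul, norm_cexp_neg_I_mul_ofReal, one_mul]

theorem enorm_FT_le (u : ℝ × ℝ → ℂ) (ζ : ℝ × ℝ) : ‖FT u ζ‖ₑ ≤ ∫⁻ p, ‖u p‖ₑ := by
  unfold FT
  refine (enorm_integral_le_lintegral_enorm _).trans (le_of_eq ?_)
  refine lintegral_congr fun p => ?_
  rw [enorm_mul, ← ofReal_norm (Complex.exp _), norm_cexp_neg_I_mul_ofReal, ENNReal.ofReal_one,
    one_mul]

theorem integrable_gaussWeight_mul_norm_FT_sq {ε : ℝ} (hε : 0 < ε) {u : ℝ × ℝ → ℂ}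
    (hu : Integrable u) : Integrable (fun ζ => ‖FT u ζ‖ ^ 2 * gaussWeight ε ζ) := by
  refine (integrable_gaussWeight hε).bdd_mul (c := (∫ p, ‖u p‖) ^ 2)
    ((continuous_FT hu).norm.pow 2).aestronglyMeasurable (Filter.Eventually.of_forall fun ζ => ?_)
  rw [norm_pow, norm_norm]
  gcongr
  exact norm_FT_le u ζ

theorem norm_FT_sq_eq (u : ℝ × ℝ → ℂ) (ζ : ℝ × ℝ) :
    ((‖FT u ζ‖ ^ 2 : ℝ) : ℂ) = ∫ r : (ℝ × ℝ) × (ℝ × ℝ),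
      Complex.exp (-(Complex.I *
        (((r.1 - r.2).1 * ζ.1 + (r.1 - r.2).2 * ζ.2 : ℝ) : ℂ))) *
        (u r.1 * (starRingEnd ℂ) (u r.2)) := by
  rw [Complex.ofReal_pow, ← Complex.mul_conj']
  conv_lhs => unfold FT
  rw [← integral_conj, Measure.volume_eq_prod (ℝ × ℝ) (ℝ × ℝ), ← integral_prod_mul]
  refine integral_congr_ae (Filter.Eventually.of_forall fun r => ?_)
  simp only [map_mul, ← Complex.exp_conj, map_neg, Complex.conj_I, Complex.conj_ofReal]
  have : Complex.exp (-(Complex.I *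
        (((r.1 - r.2).1 * ζ.1 + (r.1 - r.2).2 * ζ.2 : ℝ) : ℂ))) =
      Complex.exp (-(Complex.I * ((r.1.1 * ζ.1 + r.1.2 * ζ.2 : ℝ) : ℂ))) *
      Complex.exp (-(-Complex.I * ((r.2.1 * ζ.1 + r.2.2 * ζ.2 : ℝ) : ℂ))) := by
    rw [← Complex.exp_add]
    congr 1
    simp only [Prod.fst_sub, Prod.snd_sub]
    push_cast
    ring
  rw [this]
  ring

theorem integral_gaussWeight_mul_norm_FT_sq {ε : ℝ} (hε : 0 < ε) {u : ℝ × ℝ → ℂ}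
    (hu : Integrable u) :
    ((∫ ζ, ‖FT u ζ‖ ^ 2 * gaussWeight ε ζ : ℝ) : ℂ) = ∫ r : (ℝ × ℝ) × (ℝ × ℝ),
      ((π / ε * gaussWeight (1 / (4 * ε)) (r.1 - r.2) : ℝ) : ℂ) *
        (u r.1 * (starRingEnd ℂ) (u r.2)) := by
  have huc : Integrable (fun q => (starRingEnd ℂ) (u q)) :=
    ⟨Complex.continuous_conj.comp_aestronglyMeasurable hu.1, by
      simpa [HasFiniteIntegral] using hu.2⟩
  have h1 : Integrable (fun s : (ℝ × ℝ) × ((ℝ × ℝ) × (ℝ × ℝ)) =>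
      (gaussWeight ε s.1 : ℂ) * (u s.2.1 * (starRingEnd ℂ) (u s.2.2))) :=
    (integrable_gaussWeight hε).ofReal.mul_prod (hu.mul_prod huc)
  have h2 := h1.bdd_mul (c := 1)
    (f := fun s : (ℝ × ℝ) × ((ℝ × ℝ) × (ℝ × ℝ)) => Complex.exp (-(Complex.I *
        (((s.2.1 - s.2.2).1 * s.1.1 + (s.2.1 - s.2.2).2 * s.1.2 : ℝ) : ℂ))))
    (Continuous.aestronglyMeasurable (by fun_prop))
    (Filter.Eventually.of_forall fun s => (norm_cexp_neg_I_mul_ofReal _).le)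
  have h3 := integral_integral_swap (f := fun (ζ : ℝ × ℝ) (r : (ℝ × ℝ) × (ℝ × ℝ)) =>
      Complex.exp (-(Complex.I * (((r.1 - r.2).1 * ζ.1 + (r.1 - r.2).2 * ζ.2 : ℝ) : ℂ))) *
        ((gaussWeight ε ζ : ℂ) * (u r.1 * (starRingEnd ℂ) (u r.2)))) h2
  rw [← integral_complex_ofReal]
  calc _ = ∫ ζ : ℝ × ℝ, ∫ r : (ℝ × ℝ) × (ℝ × ℝ),
      Complex.exp (-(Complex.I * (((r.1 - r.2).1 * ζ.1 + (r.1 - r.2).2 * ζ.2 : ℝ) : ℂ))) *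
        ((gaussWeight ε ζ : ℂ) * (u r.1 * (starRingEnd ℂ) (u r.2))) := by
        refine integral_congr_ae (Filter.Eventually.of_forall fun ζ => ?_)
        simp only
        rw [Complex.ofReal_mul, norm_FT_sq_eq, ← integral_mul_const]
        refine integral_congr_ae (Filter.Eventually.of_forall fun r => ?_)
        simp only
        ring
    _ = _ := h3
    _ = _ := by
        refine integral_congr_ae (Filter.Eventually.of_forall fun r => ?_)
        simp only
        rw [← FT_gaussWeight hε, ← integral_mul_const]
        refine integral_congr_ae (Filter.Eventually.of_forall fun ζ => ?_)
        simp only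
        ring

theorem ENNReal.two_mul_mul_le_add_sq (x y : ℝ≥0∞) : 2 * (x * y) ≤ x ^ 2 + y ^ 2 := by
  induction x using ENNReal.recTopCoe with
  | top => simp
  | coe x =>
    induction y using ENNReal.recTopCoe with
    | top => simp
    | coe y =>
      have := two_mul_le_add_sq x y
      rw [← mul_assoc]
      exact_mod_cast this

theorem ENNReal.add_sq_le (x y : ℝ≥0∞) : (x + y) ^ 2 ≤ 2 * x ^ 2 + 2 * y ^ 2 := by
  calc (x + y) ^ 2 = x ^ 2 + y ^ 2 + 2 * (x * y) := by ring
    _ ≤ x ^ 2 + y ^ 2 + (x ^ 2 + y ^ 2) := by gcongr; exact ENNReal.two_mul_mul_le_add_sq x y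
    _ = _ := by ring

theorem ENNReal.mul_le_half_add_sq (x y : ℝ≥0∞) : x * y ≤ 2⁻¹ * (x ^ 2 + y ^ 2) := by
  rw [mul_comm 2⁻¹, ← div_eq_mul_inv, ENNReal.le_div_iff_mul_le (by simp) (by simp), mul_comm]
  exact ENNReal.two_mul_mul_le_add_sq x y

/-- Schur's test for a convolution kernel. -/
theorem lintegral_mul_mul_sub_le {u G : ℝ × ℝ → ℝ≥0∞} (hu : AEMeasurable u) (hG : Measurable G) :
    ∫⁻ r : (ℝ × ℝ) × (ℝ × ℝ), G (r.1 - r.2) * (u r.1 * u r.2) ≤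
      (∫⁻ z, G z) * ∫⁻ p, u p ^ 2 := by
  have hm1 : AEMeasurable (fun r : (ℝ × ℝ) × (ℝ × ℝ) => G (r.1 - r.2) * u r.1 ^ 2) :=
    (hG.comp (measurable_fst.sub measurable_snd)).aemeasurable.mul
      ((hu.comp_quasiMeasurePreserving Measure.quasiMeasurePreserving_fst).pow_const 2)
  have hm2 : AEMeasurable (fun r : (ℝ × ℝ) × (ℝ × ℝ) => G (r.1 - r.2) * u r.2 ^ 2) :=
    (hG.comp (measurable_fst.sub measurable_snd)).aemeasurable.mul
      ((hu.comp_quasiMeasurePreserving Measure.quasiMeasurePreserving_snd).pow_const 2)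
  have i1 : ∫⁻ r : (ℝ × ℝ) × (ℝ × ℝ), G (r.1 - r.2) * u r.1 ^ 2 =
      (∫⁻ z, G z) * ∫⁻ p, u p ^ 2 := by
    rw [Measure.volume_eq_prod (ℝ × ℝ) (ℝ × ℝ), lintegral_prod _ hm1]
    have : ∀ p, ∫⁻ q, G (p - q) * u p ^ 2 = (∫⁻ z, G z) * u p ^ 2 := by
      intro p
      rw [lintegral_mul_const _ (by fun_prop), lintegral_sub_left_eq_self]
    simp_rw [this]
    rw [lintegral_const_mul'' _ (by fun_prop)]
  have i2 : ∫⁻ r : (ℝ × ℝ) × (ℝ × ℝ), G (r.1 - r.2) * u r.2 ^ 2 =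
      (∫⁻ z, G z) * ∫⁻ p, u p ^ 2 := by
    rw [Measure.volume_eq_prod (ℝ × ℝ) (ℝ × ℝ), lintegral_prod_symm _ hm2]
    have : ∀ q, ∫⁻ p, G (p - q) * u q ^ 2 = (∫⁻ z, G z) * u q ^ 2 := by
      intro q
      rw [lintegral_mul_const _ (by fun_prop), lintegral_sub_right_eq_self]
    simp_rw [this]
    rw [lintegral_const_mul'' _ (by fun_prop)]
  calc _ ≤ ∫⁻ r : (ℝ × ℝ) × (ℝ × ℝ),
        2⁻¹ * (G (r.1 - r.2) * u r.1 ^ 2 + G (r.1 - r.2) * u r.2 ^ 2) := by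
        refine lintegral_mono fun r => ?_
        refine (mul_le_mul_right (ENNReal.mul_le_half_add_sq _ _) _).trans (le_of_eq ?_)
        ring
    _ = _ := by
        rw [lintegral_const_mul' _ _ (by simp), lintegral_add_left' hm1, i1, i2, ← two_mul,
          ← mul_assoc, ENNReal.inv_mul_cancel (by norm_num) (by norm_num), one_mul]

theorem lintegral_norm_FT_sq_mul_gaussWeight_le {ε : ℝ} (hε : 0 < ε) {u : ℝ × ℝ → ℂ}
    (hu : Integrable u) :
    ∫⁻ ζ, ENNReal.ofReal (‖FT u ζ‖ ^ 2 * gaussWeight ε ζ) ≤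
      ENNReal.ofReal (4 * π ^ 2) * ∫⁻ p, ‖u p‖ₑ ^ 2 := by
  have hnn : ∀ z, 0 ≤ π / ε * gaussWeight (1 / (4 * ε)) z := fun z =>
    mul_nonneg (by positivity) (gaussWeight_nonneg _ _)
  rw [← ofReal_integral_eq_lintegral_ofReal (integrable_gaussWeight_mul_norm_FT_sq hε hu)
    (Filter.Eventually.of_forall fun ζ => mul_nonneg (sq_nonneg _) (gaussWeight_nonneg _ _)),
    ← Complex.norm_of_nonneg (integral_nonneg fun ζ =>
      mul_nonneg (sq_nonneg _) (gaussWeight_nonneg _ _)), ofReal_norm,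
    integral_gaussWeight_mul_norm_FT_sq hε hu]
  refine (enorm_integral_le_lintegral_enorm _).trans ?_
  have e : ∀ r : (ℝ × ℝ) × (ℝ × ℝ),
      ‖((π / ε * gaussWeight (1 / (4 * ε)) (r.1 - r.2) : ℝ) : ℂ) *
        (u r.1 * (starRingEnd ℂ) (u r.2))‖ₑ =
      (fun z => ENNReal.ofReal (π / ε * gaussWeight (1 / (4 * ε)) z)) (r.1 - r.2) *
        (‖u r.1‖ₑ * ‖u r.2‖ₑ) := by
    intro r
    rw [enorm_mul, enorm_mul, ← ofReal_norm ((_ : ℝ) : ℂ), Complex.norm_of_nonneg (hnn _),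
      ← ofReal_norm ((starRingEnd ℂ) _), RCLike.norm_conj, ofReal_norm]
  simp_rw [e]
  refine (lintegral_mul_mul_sub_le hu.1.enorm
    ((continuous_gaussWeight _).measurable.const_mul _).ennreal_ofReal).trans (le_of_eq ?_)
  congr 1
  rw [← ofReal_integral_eq_lintegral_ofReal ((integrable_gaussWeight (by positivity)).const_mul _)
    (Filter.Eventually.of_forall hnn), integral_const_mul, integral_gaussWeight (by positivity)]
  congr 1
  field_simp

/-- Plancherel's inequality for the Fourier transform of an integrable function. -/
theorem lintegral_enorm_FT_sq_le {u : ℝ × ℝ → ℂ} (hu : Integrable u) :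
    ∫⁻ ζ, ‖FT u ζ‖ₑ ^ 2 ≤ ENNReal.ofReal (4 * π ^ 2) * ∫⁻ p, ‖u p‖ₑ ^ 2 := by
  have hm : ∀ n : ℕ, Measurable fun ζ =>
      ENNReal.ofReal (‖FT u ζ‖ ^ 2 * gaussWeight (1 / ((n : ℝ) + 1)) ζ) := fun n =>
    (((continuous_FT hu).norm.pow 2).mul (continuous_gaussWeight _)).measurable.ennreal_ofReal
  have hlim : ∀ ζ, Filter.Tendsto (fun n : ℕ =>
      ENNReal.ofReal (‖FT u ζ‖ ^ 2 * gaussWeight (1 / ((n : ℝ) + 1)) ζ)) Filter.atTop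
      (nhds (‖FT u ζ‖ₑ ^ 2)) := by
    intro ζ
    rw [← ofReal_norm, ← ENNReal.ofReal_pow (norm_nonneg _)]
    refine ENNReal.tendsto_ofReal ?_
    have hc : Continuous fun ε : ℝ => ‖FT u ζ‖ ^ 2 * gaussWeight ε ζ := by
      unfold gaussWeight; fun_prop
    have := (hc.tendsto 0).comp tendsto_one_div_add_atTop_nhds_zero_nat
    simpa [gaussWeight, Function.comp_def] using this
  calc ∫⁻ ζ, ‖FT u ζ‖ₑ ^ 2 = ∫⁻ ζ, Filter.liminf (fun n : ℕ =>
      ENNReal.ofReal (‖FT u ζ‖ ^ 2 * gaussWeight (1 / ((n : ℝ) + 1)) ζ)) Filter.atTop :=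
        lintegral_congr fun ζ => (hlim ζ).liminf_eq.symm
    _ ≤ _ := lintegral_liminf_le hm
    _ ≤ _ := Filter.liminf_le_of_le (by isBoundedDefault) fun b hb => by
        obtain ⟨n, hn⟩ := hb.exists
        exact hn.trans (lintegral_norm_FT_sq_mul_gaussWeight_le (by positivity) hu)

/-! ### The Stein derivative as a singular integral over increments -/

/-- The singular kernel `|h|^{-1-2b}` of the Stein derivative. -/
def steinKernel (b h : ℝ) : ℝ≥0∞ := ENNReal.ofReal (|h| ^ (1 + 2 * b))⁻¹

theorem measurable_steinKernel (b : ℝ) : Measurable (steinKernel b) := by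
  unfold steinKernel; fun_prop

theorem steinL2norm_sq (b : ℝ) (g : ℝ × ℝ → ℂ) :
    steinL2norm b g ^ 2 =
      ∫⁻ p : ℝ × ℝ, ∫⁻ y : ℝ, ‖g p - g (y, p.2)‖ₑ ^ 2 * steinKernel b (y - p.1) := by
  have hsq : ∀ x : ℝ≥0∞, (x ^ (1 / 2 : ℝ)) ^ 2 = x := by
    intro x
    rw [← ENNReal.rpow_natCast, ← ENNReal.rpow_mul]
    norm_num
  unfold steinL2norm steinDxi
  simp_rw [hsq]
  refine lintegral_congr fun p => lintegral_congr fun y => ?_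
  rw [div_eq_mul_inv, ENNReal.ofReal_mul (by positivity), ENNReal.ofReal_pow (norm_nonneg _),
    ofReal_norm, abs_sub_comm]
  rfl

theorem lintegral_steinKernel_le {g : ℝ × ℝ → ℂ} (hg : Measurable g) (b : ℝ) {φ : ℝ → ℝ≥0∞}
    (hφ : ∀ h, ∫⁻ p : ℝ × ℝ, ‖g p - g (p.1 + h, p.2)‖ₑ ^ 2 ≤ φ h) :
    ∫⁻ p : ℝ × ℝ, ∫⁻ y : ℝ, ‖g p - g (y, p.2)‖ₑ ^ 2 * steinKernel b (y - p.1) ≤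
      ∫⁻ h, φ h * steinKernel b h := by
  have hk := measurable_steinKernel b
  calc _ = ∫⁻ p : ℝ × ℝ, ∫⁻ h : ℝ, ‖g p - g (p.1 + h, p.2)‖ₑ ^ 2 * steinKernel b h := by
        refine lintegral_congr fun p => ?_
        rw [← lintegral_add_left_eq_self _ p.1]
        simp
    _ = ∫⁻ h : ℝ, ∫⁻ p : ℝ × ℝ, ‖g p - g (p.1 + h, p.2)‖ₑ ^ 2 * steinKernel b h := by
        refine lintegral_lintegral_swap (Measurable.aemeasurable ?_)
        unfold Function.uncurry
        fun_prop
    _ ≤ _ := by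
        refine lintegral_mono fun h => ?_
        rw [lintegral_mul_const _ (by fun_prop)]
        exact mul_le_mul_left (hφ h) _

theorem lintegral_comp_abs_lt_top {F : ℝ → ℝ≥0∞} (hF : Measurable F)
    (h : ∫⁻ x in Ioi 0, F x < ⊤) : ∫⁻ x, F |x| < ⊤ := by
  have hm : Measurable ((Ioi (0 : ℝ)).indicator F) := hF.indicator measurableSet_Ioi
  calc ∫⁻ x, F |x| ≤ ∫⁻ x, ((Ioi (0 : ℝ)).indicator F x + (Ioi (0 : ℝ)).indicator F (-x)) := by
        refine lintegral_mono_ae ?_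
        filter_upwards [Measure.ae_ne volume (0 : ℝ)] with x hx
        rcases lt_or_gt_of_ne hx with hx | hx
        · simp [abs_of_neg hx, hx]
        · simp [abs_of_pos hx, hx]
    _ = 2 * ∫⁻ x in Ioi 0, F x := by
        rw [lintegral_add_left hm, lintegral_neg_eq_self, lintegral_indicator measurableSet_Ioi,
          two_mul]
    _ < ⊤ := ENNReal.mul_lt_top (by simp) h

/-- The total mass of the Stein kernel against `min 1 h²`. -/
def steinConst (b : ℝ) : ℝ≥0∞ := ∫⁻ h, ENNReal.ofReal (min 1 (h ^ 2)) * steinKernel b h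

theorem steinConst_lt_top {b : ℝ} (hb : b ∈ Ioo (0 : ℝ) 1) : steinConst b < ⊤ := by
  obtain ⟨hb0, hb1⟩ := hb
  have hm : Measurable fun h => ENNReal.ofReal (min 1 (h ^ 2)) * steinKernel b h :=
    (Measurable.ennreal_ofReal (by fun_prop)).mul (measurable_steinKernel b)
  have habs : steinConst b = ∫⁻ h, ENNReal.ofReal (min 1 (|h| ^ 2)) * steinKernel b |h| := by
    simp [steinConst, steinKernel]
  rw [habs]
  refine lintegral_comp_abs_lt_top hm ?_
  have hsplit : Ioi (0 : ℝ) = Ioc 0 1 ∪ Ioi 1 := (Ioc_union_Ioi_eq_Ioi zero_le_one).symm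
  rw [hsplit]
  refine (lintegral_union_le _ _ _).trans_lt (ENNReal.add_lt_top.2 ⟨?_, ?_⟩)
  · have hi : IntegrableOn (fun x : ℝ => x ^ (1 - 2 * b)) (Ioc 0 1) := by
      have := intervalIntegral.intervalIntegrable_rpow' (a := 0) (b := 1) (r := 1 - 2 * b)
        (by linarith)
      rwa [intervalIntegrable_iff, uIoc_of_le zero_le_one] at this
    refine (setLIntegral_mono' measurableSet_Ioc fun x hx => ?_).trans_lt hi.lintegral_lt_top
    have hx0 : 0 < x := hx.1
    rw [steinKernel, ← ENNReal.ofReal_mul (by positivity), abs_of_pos hx0]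
    refine ENNReal.ofReal_le_ofReal ?_
    calc min 1 (x ^ 2) * (x ^ (1 + 2 * b))⁻¹ ≤ x ^ (2 : ℝ) * (x ^ (1 + 2 * b))⁻¹ := by
          gcongr
          rw [Real.rpow_two]
          exact min_le_right _ _
      _ = x ^ (1 - 2 * b) := by
          rw [← Real.rpow_neg hx0.le, ← Real.rpow_add hx0]
          ring_nf
  · have hi : IntegrableOn (fun x : ℝ => x ^ (-(1 + 2 * b))) (Ioi 1) :=
      integrableOn_Ioi_rpow_of_lt (by linarith) one_pos
    refine (setLIntegral_mono' measurableSet_Ioi fun x hx => ?_).trans_lt hi.lintegral_lt_top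
    have hx0 : 0 < x := zero_lt_one.trans hx
    rw [steinKernel, ← ENNReal.ofReal_mul (by positivity), abs_of_pos hx0]
    refine ENNReal.ofReal_le_ofReal ?_
    rw [Real.rpow_neg hx0.le]
    exact mul_le_of_le_one_left (by positivity) (min_le_left _ _)

theorem lintegral_steinKernel_le_mul_steinConst {g : ℝ × ℝ → ℂ} (hg : Measurable g) (b : ℝ)
    {K : ℝ≥0∞} (hK : ∀ h, ∫⁻ p : ℝ × ℝ, ‖g p - g (p.1 + h, p.2)‖ₑ ^ 2 ≤
      K * ENNReal.ofReal (min 1 (h ^ 2))) :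
    ∫⁻ p : ℝ × ℝ, ∫⁻ y : ℝ, ‖g p - g (y, p.2)‖ₑ ^ 2 * steinKernel b (y - p.1) ≤
      K * steinConst b := by
  refine (lintegral_steinKernel_le hg b hK).trans (le_of_eq ?_)
  simp_rw [mul_assoc]
  exact lintegral_const_mul _
    ((Measurable.ennreal_ofReal (by fun_prop)).mul (measurable_steinKernel b))

/-! ### Leibniz rule for the Stein derivative -/

theorem steinL2norm_mul_sq_le {Φ G : ℝ × ℝ → ℂ} (hΦ : Measurable Φ) (hG : Measurable G) (b : ℝ)
    {M N K L : ℝ≥0∞} (hM : ∀ p, ‖Φ p‖ₑ ≤ M) (hN : ∀ p, ‖G p‖ₑ ≤ N)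
    (hK : ∀ h, ∫⁻ p : ℝ × ℝ, ‖Φ p - Φ (p.1 + h, p.2)‖ₑ ^ 2 ≤ K * ENNReal.ofReal (min 1 (h ^ 2)))
    (hL : ∀ h, ∫⁻ p : ℝ × ℝ, ‖G p - G (p.1 + h, p.2)‖ₑ ^ 2 ≤ L * ENNReal.ofReal (min 1 (h ^ 2))) :
    steinL2norm b (fun p => Φ p * G p) ^ 2 ≤
      2 * (N ^ 2 * K + M ^ 2 * L) * steinConst b := by
  rw [steinL2norm_sq]
  refine (lintegral_steinKernel_le_mul_steinConst (hΦ.mul hG) b fun h => ?_)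
  calc ∫⁻ p : ℝ × ℝ, ‖Φ p * G p - Φ (p.1 + h, p.2) * G (p.1 + h, p.2)‖ₑ ^ 2
      ≤ ∫⁻ p : ℝ × ℝ, (2 * N ^ 2 * ‖Φ p - Φ (p.1 + h, p.2)‖ₑ ^ 2 +
          2 * M ^ 2 * ‖G p - G (p.1 + h, p.2)‖ₑ ^ 2) := by
        refine lintegral_mono fun p => ?_
        have e : Φ p * G p - Φ (p.1 + h, p.2) * G (p.1 + h, p.2) =
            (Φ p - Φ (p.1 + h, p.2)) * G p +
              Φ (p.1 + h, p.2) * (G p - G (p.1 + h, p.2)) := by ring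
        have e2 : ‖Φ p * G p - Φ (p.1 + h, p.2) * G (p.1 + h, p.2)‖ₑ ≤
            ‖Φ p - Φ (p.1 + h, p.2)‖ₑ * N + M * ‖G p - G (p.1 + h, p.2)‖ₑ := by
          rw [e]
          refine (enorm_add_le _ _).trans ?_
          rw [enorm_mul, enorm_mul]
          gcongr
          · exact hN p
          · exact hM _
        refine (pow_le_pow_left' e2 2).trans ((ENNReal.add_sq_le _ _).trans (le_of_eq ?_))
        ring
    _ = 2 * N ^ 2 * (∫⁻ p : ℝ × ℝ, ‖Φ p - Φ (p.1 + h, p.2)‖ₑ ^ 2) +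
          2 * M ^ 2 * ∫⁻ p : ℝ × ℝ, ‖G p - G (p.1 + h, p.2)‖ₑ ^ 2 := by
        rw [lintegral_add_left (by fun_prop), lintegral_const_mul _ (by fun_prop),
          lintegral_const_mul _ (by fun_prop)]
    _ ≤ 2 * N ^ 2 * (K * ENNReal.ofReal (min 1 (h ^ 2))) +
          2 * M ^ 2 * (L * ENNReal.ofReal (min 1 (h ^ 2))) := by
        gcongr
        · exact hK h
        · exact hL h
    _ = _ := by ring

/-! ### Increments of the Fourier transform -/

theorem FT_sub_FT_add {f : ℝ × ℝ → ℂ} (hf : Integrable f) (h : ℝ) (p : ℝ × ℝ) :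
    FT f p - FT f (p.1 + h, p.2) =
      FT (fun q => (1 - Complex.exp (-(Complex.I * ((q.1 * h : ℝ) : ℂ)))) * f q) p := by
  unfold FT
  have hi : ∀ ζ : ℝ × ℝ, Integrable fun q : ℝ × ℝ =>
      Complex.exp (-(Complex.I * ((q.1 * ζ.1 + q.2 * ζ.2 : ℝ) : ℂ))) * f q := fun ζ =>
    hf.bdd_mul (c := 1) (Continuous.aestronglyMeasurable (by fun_prop))
      (Filter.Eventually.of_forall fun q => (norm_cexp_neg_I_mul_ofReal _).le)
  rw [← integral_sub (hi p) (hi (p.1 + h, p.2))]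
  refine integral_congr_ae (Filter.Eventually.of_forall fun q => ?_)
  have : Complex.exp (-(Complex.I * ((q.1 * (p.1 + h) + q.2 * p.2 : ℝ) : ℂ))) =
      Complex.exp (-(Complex.I * ((q.1 * p.1 + q.2 * p.2 : ℝ) : ℂ))) *
        Complex.exp (-(Complex.I * ((q.1 * h : ℝ) : ℂ))) := by
    rw [← Complex.exp_add]
    congr 1
    push_cast
    ring
  simp only [this]
  ring

theorem norm_one_sub_cexp_le (x : ℝ) :
    ‖1 - Complex.exp (-(Complex.I * (x : ℂ)))‖ ≤ |x| := by
  have := Real.norm_exp_I_mul_ofReal_sub_one_le (x := -x)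
  rw [norm_sub_rev]
  simpa using this

theorem norm_one_sub_cexp_sq_le (x h : ℝ) :
    ‖1 - Complex.exp (-(Complex.I * ((x * h : ℝ) : ℂ)))‖ ^ 2 ≤
      4 * min 1 (h ^ 2) * (1 + x ^ 2) ^ 2 := by
  have h1 := norm_one_sub_cexp_le (x * h)
  have h2 : ‖1 - Complex.exp (-(Complex.I * ((x * h : ℝ) : ℂ)))‖ ≤ 2 := by
    refine (norm_sub_le _ _).trans ?_
    rw [norm_cexp_neg_I_mul_ofReal, norm_one]
    norm_num
  have h3 := norm_nonneg (1 - Complex.exp (-(Complex.I * ((x * h : ℝ) : ℂ))))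
  set n := ‖1 - Complex.exp (-(Complex.I * ((x * h : ℝ) : ℂ)))‖
  have h4 : n ^ 2 ≤ x ^ 2 * h ^ 2 := by
    rw [← mul_pow, ← sq_abs (x * h)]
    gcongr
  have hx : 1 ≤ (1 + x ^ 2) ^ 2 := by nlinarith [sq_nonneg x]
  have hx' : x ^ 2 ≤ (1 + x ^ 2) ^ 2 := by nlinarith [sq_nonneg x]
  rcases min_cases 1 (h ^ 2) with ⟨hm, -⟩ | ⟨hm, -⟩ <;> rw [hm]
  · nlinarith
  · nlinarith [mul_le_mul_of_nonneg_right hx' (sq_nonneg h), sq_nonneg h, sq_nonneg x,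
      mul_nonneg (sq_nonneg h) (sq_nonneg (1 + x ^ 2))]

theorem lintegral_enorm_FT_sub_sq_le {f : ℝ × ℝ → ℂ} (hf : Integrable f) (h : ℝ) :
    ∫⁻ p : ℝ × ℝ, ‖FT f p - FT f (p.1 + h, p.2)‖ₑ ^ 2 ≤
      (ENNReal.ofReal (16 * π ^ 2) * ∫⁻ p : ℝ × ℝ, ‖((1 + p.1 ^ 2 : ℝ) : ℂ) * f p‖ₑ ^ 2) *
        ENNReal.ofReal (min 1 (h ^ 2)) := by
  simp_rw [FT_sub_FT_add hf h]
  have hi : Integrable fun q : ℝ × ℝ =>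
      (1 - Complex.exp (-(Complex.I * ((q.1 * h : ℝ) : ℂ)))) * f q := by
    refine hf.bdd_mul (c := 2) (Continuous.aestronglyMeasurable (by fun_prop))
      (Filter.Eventually.of_forall fun q => (norm_sub_le _ _).trans ?_)
    rw [norm_cexp_neg_I_mul_ofReal, norm_one]
    norm_num
  refine (lintegral_enorm_FT_sq_le hi).trans ?_
  calc _ ≤ ENNReal.ofReal (4 * π ^ 2) * ∫⁻ p : ℝ × ℝ, ENNReal.ofReal (4 * min 1 (h ^ 2)) *
        ‖((1 + p.1 ^ 2 : ℝ) : ℂ) * f p‖ₑ ^ 2 := by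
        gcongr with p
        rw [enorm_mul, enorm_mul, mul_pow, mul_pow, ← mul_assoc]
        gcongr
        rw [← ofReal_norm, ← ofReal_norm, Complex.norm_of_nonneg (by positivity),
          ← ENNReal.ofReal_pow (norm_nonneg _), ← ENNReal.ofReal_pow (by positivity),
          ← ENNReal.ofReal_mul (by positivity)]
        exact ENNReal.ofReal_le_ofReal (norm_one_sub_cexp_sq_le _ _)
    _ = _ := by
        rw [lintegral_const_mul' _ _ ENNReal.ofReal_ne_top,
          ENNReal.ofReal_mul (p := 4) (q := min 1 (h ^ 2)) (by norm_num),
          show (16 * π ^ 2) = (4 * π ^ 2) * 4 by ring,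
          ENNReal.ofReal_mul (p := 4 * π ^ 2) (q := 4) (by positivity)]
        ring

/-! ### Weighted control of the integral -/

theorem lintegral_one_add_sq_rpow_lt_top {r : ℝ} (hr : 1 < r) :
    ∫⁻ x : ℝ, ENNReal.ofReal ((1 + x ^ 2) ^ (-r / 2)) < ⊤ := by
  have := (integrable_rpow_neg_one_add_norm_sq (E := ℝ) (μ := volume) (r := r)
    (by simpa using hr)).lintegral_lt_top
  simpa [Real.norm_eq_abs, sq_abs] using this

theorem exists_lintegral_enorm_sq_le {s : ℝ} (hs : 1 < s) :
    ∃ c : ℝ≥0∞, c ≠ ⊤ ∧ ∀ f : ℝ × ℝ → ℂ, AEStronglyMeasurable f →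
      (∫⁻ p, ‖f p‖ₑ) ^ 2 ≤ c * ((∫⁻ p : ℝ × ℝ, ‖((1 + p.1 ^ 2 : ℝ) : ℂ) * f p‖ₑ ^ 2) +
        ∫⁻ p : ℝ × ℝ, ‖(((1 + p.2 ^ 2) ^ (s / 2) : ℝ) : ℂ) * f p‖ₑ ^ 2) := by
  refine ⟨(∫⁻ x : ℝ, ENNReal.ofReal ((1 + x ^ 2) ^ (-2 / 2 : ℝ))) *
    ∫⁻ x : ℝ, ENNReal.ofReal ((1 + x ^ 2) ^ (-s / 2)),
    (ENNReal.mul_lt_top (lintegral_one_add_sq_rpow_lt_top (by norm_num))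
      (lintegral_one_add_sq_rpow_lt_top hs)).ne, fun f hf => ?_⟩
  set v : ℝ × ℝ → ℝ := fun p => (1 + p.1 ^ 2) ^ (-2 / 4 : ℝ) * (1 + p.2 ^ 2) ^ (-s / 4)
  set w : ℝ × ℝ → ℝ := fun p => (1 + p.1 ^ 2) ^ (2 / 4 : ℝ) * (1 + p.2 ^ 2) ^ (s / 4)
  have hp1 : ∀ x : ℝ, 0 < 1 + x ^ 2 := fun x => by positivity
  have hvm : Measurable v := by fun_prop
  have hwm : Measurable w := by fun_prop
  have hv0 : ∀ p, 0 ≤ v p := fun p => by positivity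
  have hw0 : ∀ p, 0 ≤ w p := fun p => by positivity
  have hvw : ∀ p, v p * w p = 1 := fun p => by
    simp only [v, w]
    rw [mul_mul_mul_comm, ← Real.rpow_add (hp1 _), ← Real.rpow_add (hp1 _)]
    ring_nf
    simp
  have hv2 : ∀ p, ENNReal.ofReal (v p) ^ 2 = ENNReal.ofReal ((1 + p.1 ^ 2) ^ (-2 / 2 : ℝ)) *
      ENNReal.ofReal ((1 + p.2 ^ 2) ^ (-s / 2)) := fun p => by
    rw [← ENNReal.ofReal_pow (hv0 p), ← ENNReal.ofReal_mul (by positivity)]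
    simp only [v]
    rw [mul_pow, ← Real.rpow_mul_natCast (hp1 _).le, ← Real.rpow_mul_natCast (hp1 _).le]
    congr 3 <;> push_cast <;> ring
  have hw2 : ∀ p, (w p) ^ 2 ≤ (1 + p.1 ^ 2) ^ 2 + ((1 + p.2 ^ 2) ^ (s / 2)) ^ 2 := fun p => by
    have : (w p) ^ 2 = (1 + p.1 ^ 2) * (1 + p.2 ^ 2) ^ (s / 2) := by
      simp only [w]
      rw [mul_pow, ← Real.rpow_mul_natCast (hp1 _).le, ← Real.rpow_mul_natCast (hp1 _).le]
      congr 1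
      · norm_num
      · congr 1; push_cast; ring
    rw [this]
    nlinarith [sq_nonneg ((1 + p.1 ^ 2) - (1 + p.2 ^ 2) ^ (s / 2)), sq_nonneg (1 + p.1 ^ 2),
      sq_nonneg ((1 + p.2 ^ 2) ^ (s / 2))]
  have holder := ENNReal.lintegral_mul_le_Lp_mul_Lq (volume : Measure (ℝ × ℝ))
    Real.HolderConjugate.two_two (f := fun p => ENNReal.ofReal (v p))
    (g := fun p => ENNReal.ofReal (w p) * ‖f p‖ₑ) hvm.ennreal_ofReal.aemeasurable
    (hwm.ennreal_ofReal.aemeasurable.mul hf.enorm)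
  have e1 : ∀ p, ((fun p => ENNReal.ofReal (v p)) * fun p => ENNReal.ofReal (w p) * ‖f p‖ₑ) p =
      ‖f p‖ₑ := fun p => by
    simp only [Pi.mul_apply]
    rw [← mul_assoc, ← ENNReal.ofReal_mul (hv0 p), hvw, ENNReal.ofReal_one, one_mul]
  simp_rw [e1, ENNReal.rpow_two] at holder
  have hsq : ∀ x : ℝ≥0∞, (x ^ (1 / 2 : ℝ)) ^ 2 = x := by
    intro x
    rw [← ENNReal.rpow_natCast, ← ENNReal.rpow_mul]
    norm_num
  refine (pow_le_pow_left' holder 2).trans ?_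
  rw [mul_pow, hsq, hsq]
  refine mul_le_mul' (le_of_eq ?_) ?_
  · simp_rw [hv2]
    rw [Measure.volume_eq_prod]
    exact lintegral_prod_mul (f := fun x : ℝ => ENNReal.ofReal ((1 + x ^ 2) ^ (-2 / 2 : ℝ)))
      (g := fun x : ℝ => ENNReal.ofReal ((1 + x ^ 2) ^ (-s / 2)))
      (Measurable.aemeasurable (by fun_prop)) (Measurable.aemeasurable (by fun_prop))
  · have hm : AEMeasurable (fun p : ℝ × ℝ => ‖((1 + p.1 ^ 2 : ℝ) : ℂ) * f p‖ₑ ^ 2) :=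
      (AEStronglyMeasurable.mul (Continuous.aestronglyMeasurable (by fun_prop)) hf).enorm.pow_const 2
    rw [← lintegral_add_left' hm]
    refine lintegral_mono fun p => ?_
    rw [enorm_mul, enorm_mul, mul_pow, mul_pow, mul_pow, ← add_mul]
    gcongr
    rw [← ofReal_norm, ← ofReal_norm, Complex.norm_of_nonneg (by positivity),
      Complex.norm_of_nonneg (by positivity), ← ENNReal.ofReal_pow (hw0 p),
      ← ENNReal.ofReal_pow (by positivity), ← ENNReal.ofReal_pow (by positivity),
      ← ENNReal.ofReal_add (by positivity) (by positivity)]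
    exact ENNReal.ofReal_le_ofReal (hw2 p)

/-! ### Increments of the symbol -/

theorem abs_rpow_sub_rpow_le {a x y : ℝ} (ha0 : 0 < a) (ha1 : a < 1) (hx : 0 < x) (hy : 0 ≤ y) :
    |x ^ a - y ^ a| ≤ |x - y| * x ^ (a - 1) := by
  have ex : x ^ a = x * x ^ (a - 1) := by
    rw [← Real.rpow_one_add' hx.le (by linarith)]; ring_nf
  rcases hy.eq_or_lt with rfl | hy
  · rw [Real.zero_rpow ha0.ne', sub_zero, sub_zero, abs_of_pos hx, ← ex, abs_of_nonneg]
    positivity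
  have ey : y ^ a = y * y ^ (a - 1) := by
    rw [← Real.rpow_one_add' hy.le (by linarith)]; ring_nf
  rcases le_total y x with h | h
  · have h1 : x ^ (a - 1) ≤ y ^ (a - 1) := Real.rpow_le_rpow_of_nonpos hy h (by linarith)
    rw [abs_of_nonneg (sub_nonneg.2 (Real.rpow_le_rpow hy.le h ha0.le)),
      abs_of_nonneg (sub_nonneg.2 h), ex, ey]
    nlinarith
  · have h1 : y ^ (a - 1) ≤ x ^ (a - 1) := Real.rpow_le_rpow_of_nonpos hx h (by linarith)
    rw [abs_of_nonpos (sub_nonpos.2 (Real.rpow_le_rpow hx.le h ha0.le)),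
      abs_of_nonpos (sub_nonpos.2 h), ex, ey]
    nlinarith

theorem abs_abs_rpow_sub_abs_rpow_le {a u v : ℝ} (ha0 : 0 < a) (ha1 : a < 1) (hu : u ≠ 0) :
    |(|u| ^ a - |v| ^ a)| ≤ |u - v| * |u| ^ (a - 1) :=
  (abs_rpow_sub_rpow_le ha0 ha1 (abs_pos.2 hu) (abs_nonneg v)).trans
    (mul_le_mul_of_nonneg_right (abs_abs_sub_abs_le u v) (by positivity))

theorem abs_rpow_le_three {a u : ℝ} (ha0 : 0 < a) (ha1 : a < 1) (hu : |u| ≤ 3) : |u| ^ a ≤ 3 := by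
  calc |u| ^ a ≤ 3 ^ a := Real.rpow_le_rpow (abs_nonneg _) hu ha0.le
    _ ≤ 3 ^ (1 : ℝ) := Real.rpow_le_rpow_of_exponent_le (by norm_num) ha1.le
    _ = 3 := Real.rpow_one 3

theorem abs_mul_abs_rpow_sub_le {a u v : ℝ} (ha0 : 0 < a) (ha1 : a < 1) (hu : u ≠ 0)
    (hu3 : |u| ≤ 3) (hv3 : |v| ≤ 3) :
    |u * |u| ^ (1 + a) - v * |v| ^ (1 + a)| ≤ 27 * |u - v| := by
  have e : ∀ w : ℝ, w * |w| ^ (1 + a) = w * |w| * |w| ^ a := fun w => by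
    rw [Real.rpow_one_add' (abs_nonneg w) (by linarith), mul_assoc]
  have hm := abs_abs_rpow_sub_abs_rpow_le (v := v) ha0 ha1 hu
  have hu0 : 0 < |u| := abs_pos.2 hu
  have h1 : |(u * |u| - v * |v|)| ≤ 6 * |u - v| := by
    have : u * |u| - v * |v| = (u - v) * |u| + v * (|u| - |v|) := by ring
    rw [this]
    refine (abs_add_le _ _).trans ?_
    rw [abs_mul, abs_mul, abs_abs]
    nlinarith [abs_abs_sub_abs_le u v, abs_nonneg (u - v), abs_nonneg v]
  have h2 : |u| * |u| * |u| ^ (a - 1) ≤ 9 := by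
    have : |u| * |u| ^ (a - 1) = |u| ^ a := by
      rw [← Real.rpow_one_add' hu0.le (by linarith)]; ring_nf
    rw [mul_assoc, this]
    nlinarith [abs_rpow_le_three ha0 ha1 hu3, Real.rpow_nonneg hu0.le a]
  have e2 : u * |u| * |u| ^ a - v * |v| * |v| ^ a =
      (u * |u| - v * |v|) * |v| ^ a + u * |u| * (|u| ^ a - |v| ^ a) := by ring
  rw [e, e, e2]
  refine (abs_add_le _ _).trans ?_
  rw [abs_mul, abs_mul, abs_mul, abs_abs, abs_of_nonneg (Real.rpow_nonneg (abs_nonneg v) a)]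
  have h3 : |(u * |u| - v * |v|)| * |v| ^ a ≤ 6 * |u - v| * 3 :=
    mul_le_mul h1 (abs_rpow_le_three ha0 ha1 hv3) (by positivity) (by positivity)
  have h4 : |u| * |u| * |(|u| ^ a - |v| ^ a)| ≤ |u - v| * 9 := by
    calc _ ≤ |u| * |u| * (|u - v| * |u| ^ (a - 1)) := by gcongr
      _ = |u - v| * (|u| * |u| * |u| ^ (a - 1)) := by ring
      _ ≤ _ := by gcongr
  linarith

theorem norm_psi (a t : ℝ) (ζ : ℝ × ℝ) : ‖psi a t ζ‖ = 1 := by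
  rw [psi, mul_comm, Complex.norm_exp_ofReal_mul_I]

theorem continuous_psi {a : ℝ} (ha0 : 0 < a) (t : ℝ) : Continuous (psi a t) := by
  have : Continuous fun ζ : ℝ × ℝ => |ζ.1| ^ (1 + a) :=
    continuous_fst.abs.rpow_const fun _ => Or.inr (by linarith)
  unfold psi
  fun_prop

theorem norm_psi_sub_le {a t u v η : ℝ} (ha0 : 0 < a) (ha1 : a < 1) (ht : 0 ≤ t) (hu : u ≠ 0)
    (hu3 : |u| ≤ 3) (hv3 : |v| ≤ 3) (hη : |η| ≤ 2) :
    ‖psi a t (u, η) - psi a t (v, η)‖ ≤ 31 * t * |u - v| := by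
  have e : psi a t (u, η) - psi a t (v, η) = psi a t (u, η) *
      (1 - Complex.exp (-(Complex.I * ((t * (u * (η ^ 2 - |u| ^ (1 + a)) -
        v * (η ^ 2 - |v| ^ (1 + a))) : ℝ) : ℂ)))) := by
    rw [mul_sub, mul_one]
    congr 1
    unfold psi
    rw [← Complex.exp_add]
    congr 1
    push_cast
    ring
  rw [e, norm_mul, norm_psi, one_mul]
  refine (norm_one_sub_cexp_le _).trans ?_
  rw [abs_mul, abs_of_nonneg ht, show u * (η ^ 2 - |u| ^ (1 + a)) - v * (η ^ 2 - |v| ^ (1 + a)) =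
    η ^ 2 * (u - v) - (u * |u| ^ (1 + a) - v * |v| ^ (1 + a)) by ring]
  have h1 : |η ^ 2 * (u - v)| ≤ 4 * |u - v| := by
    rw [abs_mul, abs_of_nonneg (sq_nonneg η)]
    gcongr
    nlinarith [sq_abs η, abs_nonneg η]
  have h2 := (abs_sub (η ^ 2 * (u - v)) (u * |u| ^ (1 + a) - v * |v| ^ (1 + a))).trans
    (add_le_add h1 (abs_mul_abs_rpow_sub_le ha0 ha1 hu hu3 hv3))
  calc _ ≤ t * (4 * |u - v| + 27 * |u - v|) := by gcongr
    _ = _ := by ring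

theorem lintegral_weight_lt_top {a : ℝ} (ha : 1 / 2 < a) :
    ∫⁻ p in Icc (-3 : ℝ) 3 ×ˢ Icc (-2 : ℝ) 2, ENNReal.ofReal ((1 + |p.1| ^ (a - 1)) ^ 2) < ⊤ := by
  have h1 : ∫⁻ x : ℝ, (Iic (3 : ℝ)).indicator
      (fun x => ENNReal.ofReal ((1 + |x| ^ (a - 1)) ^ 2)) |x| < ⊤ := by
    refine lintegral_comp_abs_lt_top
      (Measurable.indicator (Measurable.ennreal_ofReal (by fun_prop)) measurableSet_Iic) ?_
    rw [lintegral_indicator measurableSet_Iic, Measure.restrict_restrict measurableSet_Iic,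
      inter_comm, Ioi_inter_Iic]
    have hi : ∀ r : ℝ, -1 < r → IntegrableOn (fun x : ℝ => x ^ r) (Ioc 0 3) := fun r hr => by
      have := intervalIntegral.intervalIntegrable_rpow' (a := 0) (b := 3) hr
      rwa [intervalIntegrable_iff, uIoc_of_le (by norm_num)] at this
    have hi2 : IntegrableOn (fun x : ℝ => 2 + 2 * x ^ (2 * a - 2)) (Ioc 0 3) :=
      (integrableOn_const (by simp)).add ((hi _ (by linarith)).const_mul 2)
    refine (setLIntegral_mono' measurableSet_Ioc fun x hx => ?_).trans_lt hi2.lintegral_lt_top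
    refine ENNReal.ofReal_le_ofReal ?_
    have : x ^ (2 * a - 2) = (x ^ (a - 1)) ^ 2 := by
      rw [← Real.rpow_mul_natCast hx.1.le]; congr 1; push_cast; ring
    rw [this, abs_of_pos hx.1]
    nlinarith [sq_nonneg (1 - x ^ (a - 1))]
  have hm : Measurable fun x : ℝ => ENNReal.ofReal ((1 + |x| ^ (a - 1)) ^ 2) :=
    Measurable.ennreal_ofReal (by fun_prop)
  rw [Measure.volume_eq_prod, ← Measure.prod_restrict]
  have := lintegral_prod_mul (μ := volume.restrict (Icc (-3 : ℝ) 3))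
    (ν := volume.restrict (Icc (-2 : ℝ) 2)) hm.aemeasurable (g := fun _ => 1) aemeasurable_const
  simp only [mul_one] at this
  rw [this]
  refine ENNReal.mul_lt_top (lt_of_le_of_lt ?_ h1) (by simp)
  rw [← lintegral_indicator measurableSet_Icc]
  refine lintegral_mono fun x => ?_
  by_cases hx : x ∈ Icc (-3 : ℝ) 3
  · have : |x| ∈ Iic (3 : ℝ) := abs_le.2 hx
    rw [indicator_of_mem hx, indicator_of_mem this, abs_abs]
  · rw [indicator_of_notMem hx]
    exact zero_le

/-- Increment bound for a function supported in `[-2,2]²` with a mild singularity at `ξ = 0`. -/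
theorem exists_lintegral_sub_sq_le {Φ : ℝ × ℝ → ℂ} (hΦ : Measurable Φ) {a D M : ℝ}
    (ha : 1 / 2 < a) (ha1 : a < 1)
    (hsupp : ∀ p, p ∉ Icc (-2 : ℝ) 2 ×ˢ Icc (-2 : ℝ) 2 → Φ p = 0) (hM : ∀ p, ‖Φ p‖ ≤ M)
    (hlip : ∀ u v η : ℝ, u ≠ 0 → |u| ≤ 3 → |v| ≤ 3 → |η| ≤ 2 →
      ‖Φ (u, η) - Φ (v, η)‖ ≤ D * (|u - v| * (1 + |u| ^ (a - 1)))) :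
    ∃ K : ℝ≥0∞, K ≠ ⊤ ∧ ∀ h, ∫⁻ p : ℝ × ℝ, ‖Φ p - Φ (p.1 + h, p.2)‖ₑ ^ 2 ≤
      K * ENNReal.ofReal (min 1 (h ^ 2)) := by
  set W : ℝ≥0∞ := ∫⁻ p in Icc (-3 : ℝ) 3 ×ˢ Icc (-2 : ℝ) 2,
    ENNReal.ofReal ((1 + |p.1| ^ (a - 1)) ^ 2)
  set S : ℝ≥0∞ := ∫⁻ p, ‖Φ p‖ₑ ^ 2
  have hWt : W ≠ ⊤ := (lintegral_weight_lt_top ha).ne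
  have hms : MeasurableSet (Icc (-2 : ℝ) 2 ×ˢ Icc (-2 : ℝ) 2) :=
    measurableSet_Icc.prod measurableSet_Icc
  have hms3 : MeasurableSet (Icc (-3 : ℝ) 3 ×ˢ Icc (-2 : ℝ) 2) :=
    measurableSet_Icc.prod measurableSet_Icc
  have hSt : S ≠ ⊤ := by
    refine ne_of_lt (lt_of_le_of_lt (b := ∫⁻ _ in Icc (-2 : ℝ) 2 ×ˢ Icc (-2 : ℝ) 2,
      ENNReal.ofReal M ^ 2) ?_ ?_)
    · rw [← lintegral_indicator hms]
      refine lintegral_mono fun p => ?_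
      by_cases hp : p ∈ Icc (-2 : ℝ) 2 ×ˢ Icc (-2 : ℝ) 2
      · rw [indicator_of_mem hp, ← ofReal_norm]
        gcongr
        exact hM p
      · rw [hsupp p hp]
        simp
    · rw [setLIntegral_const]
      exact ENNReal.mul_lt_top (by simp)
        ((isCompact_Icc.prod isCompact_Icc).measure_lt_top)
  refine ⟨ENNReal.ofReal (D ^ 2) * W + 4 * S, ENNReal.add_ne_top.2
    ⟨ENNReal.mul_ne_top (by simp) hWt, ENNReal.mul_ne_top (by simp) hSt⟩, fun h => ?_⟩
  rcases le_total |h| 1 with hh | hh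
  · have hmin : min 1 (h ^ 2) = h ^ 2 := min_eq_right (by nlinarith [sq_abs h, abs_nonneg h])
    rw [hmin]
    refine le_trans ?_ (mul_le_mul_left (le_add_of_nonneg_right zero_le) _)
    have hae : ∀ᵐ p : ℝ × ℝ, p.1 ≠ 0 :=
      Measure.quasiMeasurePreserving_fst.ae (Measure.ae_ne volume (0 : ℝ))
    calc _ ≤ ∫⁻ p in Icc (-3 : ℝ) 3 ×ˢ Icc (-2 : ℝ) 2, ENNReal.ofReal (D ^ 2 * h ^ 2) *
          ENNReal.ofReal ((1 + |p.1| ^ (a - 1)) ^ 2) := by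
          rw [← lintegral_indicator hms3]
          refine lintegral_mono_ae ?_
          filter_upwards [hae] with p hp0
          have hh' := abs_le.1 hh
          by_cases hp : p ∈ Icc (-2 : ℝ) 2 ×ˢ Icc (-2 : ℝ) 2 ∨
              (p.1 + h, p.2) ∈ Icc (-2 : ℝ) 2 ×ˢ Icc (-2 : ℝ) 2
          · have hb : |p.1| ≤ 3 ∧ |p.1 + h| ≤ 3 ∧ |p.2| ≤ 2 := by
              simp only [mem_prod, mem_Icc] at hp
              simp only [abs_le]
              rcases hp with hp | hp <;> refine ⟨⟨?_, ?_⟩, ⟨?_, ?_⟩, ?_, ?_⟩ <;>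
                linarith [hp.1.1, hp.1.2, hp.2.1, hp.2.2]
            have hp3 : p ∈ Icc (-3 : ℝ) 3 ×ˢ Icc (-2 : ℝ) 2 :=
              ⟨abs_le.1 hb.1, abs_le.1 hb.2.2⟩
            rw [indicator_of_mem hp3, ← ofReal_norm, ← ENNReal.ofReal_pow (norm_nonneg _),
              ← ENNReal.ofReal_mul (by positivity)]
            refine ENNReal.ofReal_le_ofReal ?_
            have := hlip p.1 (p.1 + h) p.2 hp0 hb.1 hb.2.1 hb.2.2
            rw [sub_add_cancel_left, abs_neg] at this
            refine (pow_le_pow_left₀ (norm_nonneg _) this 2).trans (le_of_eq ?_)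
            rw [mul_pow, mul_pow, sq_abs]
            ring
          · push Not at hp
            rw [hsupp _ hp.1, hsupp _ hp.2]
            simp
      _ = _ := by
          rw [lintegral_const_mul' _ _ ENNReal.ofReal_ne_top, ENNReal.ofReal_mul (sq_nonneg D)]
          ring
  · have hmin : min 1 (h ^ 2) = 1 := min_eq_left (by nlinarith [sq_abs h, abs_nonneg h])
    rw [hmin, ENNReal.ofReal_one, mul_one]
    refine le_trans ?_ (le_add_of_nonneg_left zero_le)
    have hshift : ∫⁻ p : ℝ × ℝ, ‖Φ (p.1 + h, p.2)‖ₑ ^ 2 = S := by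
      have := lintegral_add_right_eq_self (μ := (volume : Measure (ℝ × ℝ)))
        (fun p => ‖Φ p‖ₑ ^ 2) (h, 0)
      refine Eq.trans (lintegral_congr fun p => ?_) this
      have e : p + (h, 0) = (p.1 + h, p.2) := Prod.ext rfl (add_zero _)
      simp only [e]
    calc _ ≤ ∫⁻ p : ℝ × ℝ, (2 * ‖Φ p‖ₑ ^ 2 + 2 * ‖Φ (p.1 + h, p.2)‖ₑ ^ 2) := by
          refine lintegral_mono fun p => ?_
          exact (pow_le_pow_left' enorm_sub_le 2).trans (ENNReal.add_sq_le _ _)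
      _ = 4 * S := by
          rw [lintegral_add_left (by fun_prop), lintegral_const_mul _ (by fun_prop),
            lintegral_const_mul _ (by fun_prop), hshift, ← add_mul]
          norm_num
          rfl

/-- The cutoff symbol `χ ψ η^n |ξ|^a`. -/
def cutoffSymbol (ϕ₀ : ℝ → ℝ) (a t : ℝ) (n : ℕ) (ζ : ℝ × ℝ) : ℂ :=
  ((ϕ₀ ζ.1 * ϕ₀ ζ.2 * ζ.2 ^ n * |ζ.1| ^ a : ℝ) : ℂ) * psi a t ζ

theorem continuous_cutoffSymbol {ϕ₀ : ℝ → ℝ} (hϕ : Continuous ϕ₀) {a : ℝ} (ha0 : 0 < a) (t : ℝ)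
    (n : ℕ) : Continuous (cutoffSymbol ϕ₀ a t n) := by
  have h1 : Continuous fun ζ : ℝ × ℝ => |ζ.1| ^ a :=
    continuous_fst.abs.rpow_const fun _ => Or.inr ha0.le
  have h2 := continuous_psi ha0 t
  unfold cutoffSymbol
  fun_prop

theorem cutoffSymbol_eq_zero {ϕ₀ : ℝ → ℝ} (h0 : ∀ x, x ∉ Icc (-2 : ℝ) 2 → ϕ₀ x = 0) (a t : ℝ)
    (n : ℕ) (p : ℝ × ℝ) (hp : p ∉ Icc (-2 : ℝ) 2 ×ˢ Icc (-2 : ℝ) 2) :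
    cutoffSymbol ϕ₀ a t n p = 0 := by
  rw [mem_prod, not_and_or] at hp
  unfold cutoffSymbol
  rcases hp with hp | hp <;> simp [h0 _ hp]

theorem abs_mul_pow_le {ϕ₀ : ℝ → ℝ} (h0 : ∀ x, x ∉ Icc (-2 : ℝ) 2 → ϕ₀ x = 0) {B : ℝ}
    (hB : ∀ x, |ϕ₀ x| ≤ B) (n : ℕ) (η : ℝ) : |ϕ₀ η * η ^ n| ≤ B * 2 ^ n := by
  have hB0 : 0 ≤ B := (abs_nonneg _).trans (hB 0)
  by_cases hη : η ∈ Icc (-2 : ℝ) 2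
  · rw [abs_mul, abs_pow]
    have := abs_le.2 hη
    gcongr
    exact hB η
  · rw [h0 η hη]
    simp only [zero_mul, abs_zero]
    positivity

theorem norm_cutoffSymbol_le {ϕ₀ : ℝ → ℝ} (h0 : ∀ x, x ∉ Icc (-2 : ℝ) 2 → ϕ₀ x = 0) {B : ℝ}
    (hB : ∀ x, |ϕ₀ x| ≤ B) {a : ℝ} (ha0 : 0 < a) (ha1 : a < 1) (t : ℝ) (n : ℕ) (p : ℝ × ℝ) :
    ‖cutoffSymbol ϕ₀ a t n p‖ ≤ B * 2 ^ n * (B * 3) := by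
  have hB0 : 0 ≤ B := (abs_nonneg _).trans (hB 0)
  by_cases hp : p.1 ∈ Icc (-2 : ℝ) 2
  · unfold cutoffSymbol
    have h3 : |p.1| ≤ 3 := (abs_le.2 hp).trans (by norm_num)
    rw [norm_mul, norm_psi, mul_one, Complex.norm_real, Real.norm_eq_abs,
      show ϕ₀ p.1 * ϕ₀ p.2 * p.2 ^ n * |p.1| ^ a = (ϕ₀ p.2 * p.2 ^ n) * (ϕ₀ p.1 * |p.1| ^ a) by ring,
      abs_mul, abs_mul (ϕ₀ p.1), abs_of_nonneg (Real.rpow_nonneg (abs_nonneg p.1) a)]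
    gcongr
    · exact abs_mul_pow_le h0 hB n p.2
    · exact hB _
    · exact abs_rpow_le_three ha0 ha1 h3
  · rw [cutoffSymbol_eq_zero h0 a t n p fun h => hp h.1, norm_zero]
    positivity

theorem norm_cutoffSymbol_sub_le {ϕ₀ : ℝ → ℝ} (h0 : ∀ x, x ∉ Icc (-2 : ℝ) 2 → ϕ₀ x = 0) {B L : ℝ}
    (hB : ∀ x, |ϕ₀ x| ≤ B) (hL : ∀ x y, |ϕ₀ x - ϕ₀ y| ≤ L * |x - y|) {a t : ℝ} (ha0 : 0 < a)
    (ha1 : a < 1) (ht : 0 ≤ t) (n : ℕ) {u v η : ℝ} (hu : u ≠ 0) (hu3 : |u| ≤ 3) (hv3 : |v| ≤ 3)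
    (hη : |η| ≤ 2) :
    ‖cutoffSymbol ϕ₀ a t n (u, η) - cutoffSymbol ϕ₀ a t n (v, η)‖ ≤
      B * 2 ^ n * (3 * L + B + 93 * B * t) * (|u - v| * (1 + |u| ^ (a - 1))) := by
  have hB0 : 0 ≤ B := (abs_nonneg _).trans (hB 0)
  have hL0 : 0 ≤ L := by simpa using (abs_nonneg _).trans (hL 1 0)
  have e : cutoffSymbol ϕ₀ a t n (u, η) - cutoffSymbol ϕ₀ a t n (v, η) =
      ((ϕ₀ η * η ^ n : ℝ) : ℂ) *
        ((((ϕ₀ u - ϕ₀ v) * |u| ^ a + ϕ₀ v * (|u| ^ a - |v| ^ a) : ℝ) : ℂ) * psi a t (u, η) +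
          ((ϕ₀ v * |v| ^ a : ℝ) : ℂ) * (psi a t (u, η) - psi a t (v, η))) := by
    unfold cutoffSymbol
    push_cast
    ring
  have hr : 0 ≤ |u| ^ (a - 1) := by positivity
  have hd : 0 ≤ |u - v| := abs_nonneg _
  have h1 : |(ϕ₀ u - ϕ₀ v) * |u| ^ a + ϕ₀ v * (|u| ^ a - |v| ^ a)| ≤
      L * |u - v| * 3 + B * (|u - v| * |u| ^ (a - 1)) := by
    refine (abs_add_le _ _).trans ?_
    rw [abs_mul, abs_mul, abs_of_nonneg (Real.rpow_nonneg (abs_nonneg u) a)]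
    gcongr
    · exact hL u v
    · exact abs_rpow_le_three ha0 ha1 hu3
    · exact hB v
    · exact abs_abs_rpow_sub_abs_rpow_le ha0 ha1 hu
  have h2 : |ϕ₀ v * |v| ^ a| ≤ B * 3 := by
    rw [abs_mul, abs_of_nonneg (Real.rpow_nonneg (abs_nonneg v) a)]
    gcongr
    · exact hB v
    · exact abs_rpow_le_three ha0 ha1 hv3
  rw [e, norm_mul, Complex.norm_real, Real.norm_eq_abs, mul_assoc (B * 2 ^ n)]
  refine mul_le_mul (abs_mul_pow_le h0 hB n η) ?_ (norm_nonneg _) (by positivity)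
  refine (norm_add_le _ _).trans ?_
  rw [norm_mul, norm_mul, norm_psi, mul_one, Complex.norm_real, Complex.norm_real,
    Real.norm_eq_abs, Real.norm_eq_abs]
  have h3 : |ϕ₀ v * |v| ^ a| * ‖psi a t (u, η) - psi a t (v, η)‖ ≤ B * 3 * (31 * t * |u - v|) :=
    mul_le_mul h2 (norm_psi_sub_le ha0 ha1 ht hu hu3 hv3 hη) (norm_nonneg _) (by positivity)
  have h4 : 0 ≤ |u - v| * |u| ^ (a - 1) := by positivity
  have h5 : 0 ≤ L * (|u - v| * |u| ^ (a - 1)) := by positivity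
  have h6 : 0 ≤ B * t * (|u - v| * |u| ^ (a - 1)) := by positivity
  have h7 : 0 ≤ B * |u - v| := by positivity
  nlinarith

/-! ### The main estimate -/

theorem FT_eq_zero_of_not_integrable {f : ℝ × ℝ → ℂ} (hf : ¬ Integrable f) (ζ : ℝ × ℝ) :
    FT f ζ = 0 := by
  refine integral_undef fun h => hf ?_
  have := h.bdd_mul (c := 1)
    (f := fun p : ℝ × ℝ => Complex.exp (Complex.I * ((p.1 * ζ.1 + p.2 * ζ.2 : ℝ) : ℂ)))
    (Continuous.aestronglyMeasurable (by fun_prop)) (Filter.Eventually.of_forall fun p => by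
      rw [mul_comm, Complex.norm_exp_ofReal_mul_I])
  refine this.congr (Filter.Eventually.of_forall fun p => ?_)
  simp only
  rw [← mul_assoc, ← Complex.exp_add, add_neg_cancel, Complex.exp_zero, one_mul]

theorem eLpNorm_two_sq (g : ℝ × ℝ → ℂ) :
    eLpNorm g 2 (volume : Measure (ℝ × ℝ)) ^ 2 = ∫⁻ p, ‖g p‖ₑ ^ 2 := by
  rw [eLpNorm_eq_lintegral_rpow_enorm_toReal (by norm_num) (by norm_num),
    ← ENNReal.rpow_natCast, ← ENNReal.rpow_mul]
  norm_num

/-- Lemma 2.13, estimate (2.14): for 1/2 < a < 1, 𝒟^θ_ξ(χ ψ η^{σ₃} |ξ|^a f̂) is controlled by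
‖J_x^{2a} f‖ + ‖⟨x⟩² f‖ + ‖⟨y⟩^{σ₄} f‖. -/
theorem steinDxi_cutoff_xi_pow_a_bound
    (a θ σ₄ : ℝ) (σ₃ : ℕ) (ha : a ∈ Ioo (1 / 2 : ℝ) 1) (hθ : θ ∈ Ioo (0 : ℝ) 1)
    (hσ₄ : 1 < σ₄)
    (ϕ₀ : ℝ → ℝ) (hϕ_smooth : ContDiff ℝ (⊤ : ℕ∞) ϕ₀)
    (hϕ_supp : tsupport ϕ₀ ⊆ Icc (-2 : ℝ) 2)
    (hϕ_one : ∀ x ∈ Ioo (-1 : ℝ) 1, ϕ₀ x = 1)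
    (t : ℝ) (ht : 0 ≤ t) :
    ∃ C : ℝ, 0 < C ∧ ∀ f : ℝ × ℝ → ℂ,
      eLpNorm (Jx (2 * a) f) 2 (volume : Measure (ℝ × ℝ)) < ⊤ →
      eLpNorm (fun p : ℝ × ℝ => ((1 + p.1 ^ 2 : ℝ) : ℂ) * f p) 2 (volume : Measure (ℝ × ℝ)) < ⊤ →
      eLpNorm (fun p : ℝ × ℝ => (((1 + p.2 ^ 2) ^ (σ₄ / 2) : ℝ) : ℂ) * f p) 2
          (volume : Measure (ℝ × ℝ)) < ⊤ →
      steinL2norm θ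
          (fun ζ => ((ϕ₀ ζ.1 * ϕ₀ ζ.2 * ζ.2 ^ σ₃ * |ζ.1| ^ a : ℝ) : ℂ) * psi a t ζ * FT f ζ) ≤
        ENNReal.ofReal C *
          (eLpNorm (Jx (2 * a) f) 2 (volume : Measure (ℝ × ℝ)) +
            eLpNorm (fun p : ℝ × ℝ => ((1 + p.1 ^ 2 : ℝ) : ℂ) * f p) 2
              (volume : Measure (ℝ × ℝ)) +
            eLpNorm (fun p : ℝ × ℝ => (((1 + p.2 ^ 2) ^ (σ₄ / 2) : ℝ) : ℂ) * f p) 2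
              (volume : Measure (ℝ × ℝ))) := by

  obtain ⟨ha2, ha1⟩ := ha
  have ha0 : 0 < a := by linarith
  have hcs : HasCompactSupport ϕ₀ := isCompact_Icc.of_isClosed_subset (isClosed_tsupport _) hϕ_supp
  have h0 : ∀ x, x ∉ Icc (-2 : ℝ) 2 → ϕ₀ x = 0 := fun x hx =>
    image_eq_zero_of_notMem_tsupport fun h => hx (hϕ_supp h)
  obtain ⟨B, hB⟩ := hcs.exists_bound_of_continuous hϕ_smooth.continuous
  have hB0 : 0 ≤ B := (norm_nonneg _).trans (hB 0)
  obtain ⟨L, hL⟩ := ContDiff.lipschitzWith_of_hasCompactSupport hcs hϕ_smooth (by simp)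
  have hL' : ∀ x y, |ϕ₀ x - ϕ₀ y| ≤ L * |x - y| := fun x y => hL.dist_le_mul x y
  have hΦm := (continuous_cutoffSymbol hϕ_smooth.continuous ha0 t σ₃).measurable
  obtain ⟨K, hKt, hK⟩ := exists_lintegral_sub_sq_le hΦm
    (D := B * 2 ^ σ₃ * (3 * L + B + 93 * B * t)) ha2 ha1
    (cutoffSymbol_eq_zero h0 a t σ₃) (norm_cutoffSymbol_le h0 hB ha0 ha1 t σ₃)
    fun u v η hu hu3 hv3 hη => norm_cutoffSymbol_sub_le h0 hB hL' ha0 ha1 ht σ₃ hu hu3 hv3 hη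
  obtain ⟨c, hct, hc⟩ := exists_lintegral_enorm_sq_le hσ₄
  set M : ℝ≥0∞ := ENNReal.ofReal (B * 2 ^ σ₃ * (B * 3))
  set C₀ : ℝ≥0∞ := 2 * (c * K + M ^ 2 * ENNReal.ofReal (16 * π ^ 2)) * steinConst θ
  have hC₀ : C₀ ≠ ⊤ := ENNReal.mul_ne_top (ENNReal.mul_ne_top (by simp)
    (ENNReal.add_ne_top.2 ⟨ENNReal.mul_ne_top hct hKt,
      ENNReal.mul_ne_top (by simp [M]) ENNReal.ofReal_ne_top⟩)) (steinConst_lt_top hθ).ne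
  refine ⟨C₀.toReal + 1, by positivity, fun f _ _ _ => ?_⟩
  by_cases hf : Integrable f
  swap
  · have hz : steinL2norm θ (fun ζ => ((ϕ₀ ζ.1 * ϕ₀ ζ.2 * ζ.2 ^ σ₃ * |ζ.1| ^ a : ℝ) : ℂ) *
        psi a t ζ * FT f ζ) = 0 := by
      simp [steinL2norm, steinDxi, FT_eq_zero_of_not_integrable hf]
    rw [hz]
    exact zero_le
  set X := eLpNorm (fun p : ℝ × ℝ => ((1 + p.1 ^ 2 : ℝ) : ℂ) * f p) 2
    (volume : Measure (ℝ × ℝ)) with hX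
  set Y := eLpNorm (fun p : ℝ × ℝ => (((1 + p.2 ^ 2) ^ (σ₄ / 2) : ℝ) : ℂ) * f p) 2
    (volume : Measure (ℝ × ℝ)) with hY
  set J := eLpNorm (Jx (2 * a) f) 2 (volume : Measure (ℝ × ℝ))
  have hX2 : ∫⁻ p : ℝ × ℝ, ‖((1 + p.1 ^ 2 : ℝ) : ℂ) * f p‖ₑ ^ 2 = X ^ 2 := (eLpNorm_two_sq _).symm
  have hY2 : ∫⁻ p : ℝ × ℝ, ‖(((1 + p.2 ^ 2) ^ (σ₄ / 2) : ℝ) : ℂ) * f p‖ₑ ^ 2 = Y ^ 2 :=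
    (eLpNorm_two_sq _).symm
  have hN := hc f hf.1
  rw [hX2, hY2] at hN
  have hG := lintegral_enorm_FT_sub_sq_le hf
  rw [hX2] at hG
  have main := steinL2norm_mul_sq_le hΦm (continuous_FT hf).measurable θ (M := M)
    (fun p => by
      rw [← ofReal_norm]
      exact ENNReal.ofReal_le_ofReal (norm_cutoffSymbol_le h0 hB ha0 ha1 t σ₃ p))
    (enorm_FT_le f) hK hG
  have hS : X ^ 2 + Y ^ 2 ≤ (J + X + Y) ^ 2 := by
    calc X ^ 2 + Y ^ 2 ≤ X ^ 2 + Y ^ 2 + (J ^ 2 + 2 * J * X + 2 * J * Y + 2 * X * Y) :=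
          le_self_add
      _ = _ := by ring
  have hfin : steinL2norm θ (fun p => cutoffSymbol ϕ₀ a t σ₃ p * FT f p) ^ 2 ≤
      (ENNReal.ofReal (C₀.toReal + 1) * (J + X + Y)) ^ 2 := by
    calc _ ≤ _ := main
      _ ≤ 2 * (c * (X ^ 2 + Y ^ 2) * K + M ^ 2 * (ENNReal.ofReal (16 * π ^ 2) * (X ^ 2 + Y ^ 2))) *
          steinConst θ := by
          gcongr
          exact le_self_add
      _ = C₀ * (X ^ 2 + Y ^ 2) := by ring
      _ ≤ C₀ * (J + X + Y) ^ 2 := by gcongr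
      _ ≤ _ := by
          rw [mul_pow]
          gcongr
          rw [ENNReal.ofReal_add ENNReal.toReal_nonneg zero_le_one, ENNReal.ofReal_toReal hC₀,
            ENNReal.ofReal_one]
          calc C₀ ≤ C₀ + (C₀ ^ 2 + C₀ + 1) := le_self_add
            _ = _ := by ring
  exact (ENNReal.pow_le_pow_left_iff two_ne_zero).1 hfin
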